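/- Let m ≥ 4. For every φ ∈ S²₀₊, the operator A := -(1/(m(m+4)))·(2·σ₁φ + (m+2)·ϑφ) satisfies ρ(A) = 0 and ρ₁₃(A) = φ. In particular, the map φ ↦ A splits the contraction ρ₁₃ on the subspace of K₊ ∩ ker(ρ) mapping onto S²₀₊. -/

import Mathlib

open Module
open scoped RealInnerProductSpace

variable {V : Type*} [NormedAddCommGroup V] [InnerProductSpace ℝ V] [FiniteDimensional ℝ V]

/-- The Ricci tensor `ρ(A)(x,y) = Tr (z ↦ A(z,x)y)`. -/
noncomputable def rho (A : V →ₗ[ℝ] V →ₗ[ℝ] V →ₗ[ℝ] V) (x y : V) : ℝ :=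
  LinearMap.trace ℝ V ((A.flip x).flip y)

/-- for `φ ∈ S²₀₊`, `A = -(1/(m(m+4)))(2σ₁φ + (m+2)ϑφ)` satisfies `ρ(A) = 0` and `ρ₁₃(A) = φ`. -/
theorem statement15 {m : ℕ} (hm : 4 ≤ m) (e : OrthonormalBasis (Fin m) ℝ V)
    (J : V →ₗ[ℝ] V) (hJ : ∀ v, J (J v) = -v)
    (hJinner : ∀ x y : V, ⟪J x, J y⟫ = ⟪x, y⟫)
    (φ : V →ₗ[ℝ] V →ₗ[ℝ] ℝ) (hsym : ∀ x y, φ x y = φ y x)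
    (hJφ : ∀ x y, φ (J x) (J y) = φ x y) (htr : ∑ i, φ (e i) (e i) = 0)
    (S : V →ₗ[ℝ] V →ₗ[ℝ] V →ₗ[ℝ] V)
    (hS : ∀ x y z, S x y z = φ x z • y - φ y z • x - φ x (J z) • J y + φ y (J z) • J x - (2 * φ x (J y)) • J z)
    (T : V →ₗ[ℝ] V →ₗ[ℝ] V →ₗ[ℝ] V)
    (hT : ∀ x y z w : V, ⟪T x y z, w⟫ =
      φ x w * ⟪y, z⟫ - φ y w * ⟪x, z⟫ + φ x (J w) * ⟪y, J z⟫ - φ y (J w) * ⟪x, J z⟫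
        - 2 * φ z (J w) * ⟪x, J y⟫)
    (A : V →ₗ[ℝ] V →ₗ[ℝ] V →ₗ[ℝ] V)
    (hA : A = (-(1 / ((m : ℝ) * ((m : ℝ) + 4)))) • ((2 : ℝ) • S + ((m : ℝ) + 2) • T)) :
    (∀ x y, rho A x y = 0) ∧ ∀ x y, (∑ i, ⟪A (e i) x (e i), y⟫) = φ x y := by
  have K : ∀ (x v : V), ∑ i, φ x (e i) * ⟪e i, v⟫ = φ x v := by
    intro x v
    conv_rhs => rw [← e.sum_repr' v, map_sum]
    refine Finset.sum_congr rfl fun i _ => ?_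
    rw [map_smul, smul_eq_mul, mul_comm]
  have hJ1 : ∀ x y : V, ⟪J x, y⟫ = -⟪x, J y⟫ := by
    intro x y
    rw [← hJinner x (J y), hJ, inner_neg_right, neg_neg]
  have hJ0 : ∀ x : V, ⟪x, J x⟫ = 0 := by
    intro x
    have h := hJ1 x x
    rw [real_inner_comm] at h
    linarith
  have hφ1 : ∀ x y : V, φ x (J y) = -φ (J x) y := by
    intro x y
    rw [← hJφ x (J y), hJ, map_neg]
  have hφ0 : ∀ x : V, φ x (J x) = 0 := by
    intro x
    have h := hφ1 x x
    rw [hsym (J x) x] at h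
    linarith
  have he : ∀ i, ⟪e i, e i⟫ = (1 : ℝ) := by
    intro i
    rw [real_inner_self_eq_norm_sq, e.norm_eq_one]; norm_num
  have hm0 : (m : ℝ) ≠ 0 := by
    have : m ≠ 0 := by omega
    exact_mod_cast this
  have hm4 : (m : ℝ) + 4 ≠ 0 := by positivity
  have hJJ : ∀ x y : V, φ (J x) (J y) = φ x y := hJφ
  have s1 : ∀ x y, ∑ i, ⟪S (e i) x y, e i⟫ = -((m : ℝ) + 2) * φ x y := by
    intro x y
    have : ∀ i, ⟪S (e i) x y, e i⟫ = φ y (e i) * ⟪e i, x⟫ - φ x y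
        - φ (J y) (e i) * ⟪e i, J x⟫ - 2 * (φ (J x) (e i) * ⟪e i, J y⟫) := by
      intro i
      rw [hS]
      simp only [inner_sub_left, inner_add_left, real_inner_smul_left, he]
      rw [hsym (e i) y, hsym (e i) (J y), hsym (e i) (J x), real_inner_comm (e i) x,
        real_inner_comm (e i) (J x), real_inner_comm (e i) (J y), hJ1 (e i) (e i), hJ0]
      ring
    simp only [this, Finset.sum_sub_distrib, ← Finset.mul_sum, K, hJφ, Finset.sum_const,
      Finset.card_univ, Fintype.card_fin, nsmul_eq_mul]
    rw [hsym y x]; ring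
  have t1 : ∀ x y, ∑ i, ⟪T (e i) x y, e i⟫ = 2 * φ x y := by
    intro x y
    have : ∀ i, ⟪T (e i) x y, e i⟫ = φ (e i) (e i) * ⟪x, y⟫ - φ x (e i) * ⟪e i, y⟫
        + φ (J x) (e i) * ⟪e i, J y⟫ + 2 * (φ (J y) (e i) * ⟪e i, J x⟫) := by
      intro i
      rw [hT, hφ0, hφ1 x, hφ1 y]
      ring
    simp only [this, Finset.sum_sub_distrib, Finset.sum_add_distrib, ← Finset.mul_sum,
      ← Finset.sum_mul, K, hJφ, htr]
    rw [hsym y x]; ring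
  have s2 : ∀ x y, ∑ i, ⟪S (e i) x (e i), y⟫ = 2 * φ x y := by
    intro x y
    have : ∀ i, ⟪S (e i) x (e i), y⟫ = φ (e i) (e i) * ⟪x, y⟫ - φ x (e i) * ⟪e i, y⟫
        + φ (J x) (e i) * ⟪e i, J y⟫ + 2 * (φ (J x) (e i) * ⟪e i, J y⟫) := by
      intro i
      rw [hS]
      simp only [inner_sub_left, inner_add_left, real_inner_smul_left]
      rw [hφ0, hφ1 x, hJ1 (e i), hsym (e i) (J x)]
      ring
    simp only [this, Finset.sum_sub_distrib, Finset.sum_add_distrib, ← Finset.mul_sum,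
      ← Finset.sum_mul, K, hJφ, htr]
    ring
  have t2 : ∀ x y, ∑ i, ⟪T (e i) x (e i), y⟫ = -((m : ℝ) + 2) * φ x y := by
    intro x y
    have : ∀ i, ⟪T (e i) x (e i), y⟫ = φ y (e i) * ⟪e i, x⟫ - φ x y
        - φ (J y) (e i) * ⟪e i, J x⟫ - 2 * (φ (J y) (e i) * ⟪e i, J x⟫) := by
      intro i
      rw [hT, hJ0, he, hsym (e i) y, hsym (e i) (J y), real_inner_comm (e i) x,
        real_inner_comm (J (e i)) x, hJ1 (e i) x]
      ring
    simp only [this, Finset.sum_sub_distrib, ← Finset.mul_sum, K, hJφ, Finset.sum_const,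
      Finset.card_univ, Fintype.card_fin, nsmul_eq_mul]
    rw [hsym y x]; ring
  have hAe : ∀ x y z w, ⟪A x y z, w⟫ = (-(1 / ((m : ℝ) * ((m : ℝ) + 4)))) *
      (2 * ⟪S x y z, w⟫ + ((m : ℝ) + 2) * ⟪T x y z, w⟫) := by
    intro x y z w
    rw [hA]
    simp only [LinearMap.smul_apply, LinearMap.add_apply, inner_add_left, real_inner_smul_left]
  constructor
  · intro x y
    have : rho A x y = ∑ i, ⟪A (e i) x y, e i⟫ := by
      rw [rho, LinearMap.trace_eq_sum_inner _ e]
      refine Finset.sum_congr rfl fun i _ => ?_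
      rw [real_inner_comm]
      rfl
    rw [this]
    simp only [hAe, ← Finset.mul_sum, Finset.sum_add_distrib, s1, t1]
    ring
  · intro x y
    simp only [hAe, ← Finset.mul_sum, Finset.sum_add_distrib, s2, t2]
    field_simp
    ring
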